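/- Example 3.3, positive spectral gap for the autocatalytic network. Let κ₁,κ₂,δ,ρ > 0 and consider the Markov chain on ℤ²_{≥0} with rates q(x, x+e₁) = κ₁, q(x, x−e₁) = δx₁, q(x, x+e₂) = κ₂, q(x, x−e₂) = δx₂, q(x, x+e₁−e₂) = ρx₁x₂, q(x, x−e₁+e₂) = ρx₁x₂ (all other transitions rate 0). Set γ₁ = δκ₁/(ρ(κ₁+κ₂)), γ₂ = δκ₂/(ρ(κ₁+κ₂)), and let π(x) = M · (1/(x₁!x₂!)) · Γ(x₁+γ₁)Γ(x₂+γ₂)/Γ(x₁+x₂+γ₁+γ₂) · ((κ₁+κ₂)/δ)^{x₁+x₂} with M = Γ(γ₁+γ₂)/(Γ(γ₁)Γ(γ₂)) · e^{−(κ₁+κ₂)/δ}. Then there exists C > 0 such that for every bounded f : ℤ²_{≥0} → ℝ one has E*(f) ≥ C · Var_π(f), where E*(f) = (1/2) Σ_{x,z} (f(x)−f(z))² π(x) q(x,z). -/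

import Mathlib

open scoped ENNReal

/-- Dirichlet form `E*(f) = (1/2) Σ_{x,z} (f(x)-f(z))² π(x) q(x,z)`, with values in `[0,∞]`. -/
noncomputable def Estar {α : Type*} (π : α → ℝ) (q : α → α → ℝ) (f : α → ℝ) : ℝ≥0∞ :=
  (∑' p : α × α, ENNReal.ofReal ((f p.1 - f p.2) ^ 2 * π p.1 * q p.1 p.2)) / 2

/-- Variance of `f` with respect to `π`. -/
noncomputable def varPi {α : Type*} (π : α → ℝ) (f : α → ℝ) : ℝ :=
  (∑' x, f x ^ 2 * π x) - (∑' x, f x * π x) ^ 2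

/-- Transition rates of the autocatalytic network of Example 3.3:
`q(x, x+e₁) = κ₁`, `q(x, x−e₁) = δx₁`, `q(x, x+e₂) = κ₂`, `q(x, x−e₂) = δx₂`,
`q(x, x+e₁−e₂) = ρx₁x₂`, `q(x, x−e₁+e₂) = ρx₁x₂`. -/
noncomputable def qAuto (κ1 κ2 δ ρ : ℝ) (x z : ℕ × ℕ) : ℝ :=
  if z = (x.1 + 1, x.2) then κ1
  else if x = (z.1 + 1, z.2) then δ * x.1
  else if z = (x.1, x.2 + 1) then κ2
  else if x = (z.1, z.2 + 1) then δ * x.2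
  else if z.1 = x.1 + 1 ∧ x.2 = z.2 + 1 then ρ * x.1 * x.2
  else if x.1 = z.1 + 1 ∧ z.2 = x.2 + 1 then ρ * x.1 * x.2
  else 0

/-- The stationary distribution of the autocatalytic network of Example 3.3,
with the explicit normalizing constant
`M = Γ(γ₁+γ₂)/(Γ(γ₁)Γ(γ₂)) · e^{−(κ₁+κ₂)/δ}`. -/
noncomputable def piAuto (κ1 κ2 δ ρ : ℝ) (x : ℕ × ℕ) : ℝ :=
  (Real.Gamma (δ * κ1 / (ρ * (κ1 + κ2)) + δ * κ2 / (ρ * (κ1 + κ2))) /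
      (Real.Gamma (δ * κ1 / (ρ * (κ1 + κ2))) * Real.Gamma (δ * κ2 / (ρ * (κ1 + κ2)))) *
    Real.exp (-((κ1 + κ2) / δ))) *
  (1 / ((x.1.factorial : ℝ) * (x.2.factorial : ℝ))) *
    (Real.Gamma ((x.1 : ℝ) + δ * κ1 / (ρ * (κ1 + κ2))) *
      Real.Gamma ((x.2 : ℝ) + δ * κ2 / (ρ * (κ1 + κ2))) /
      Real.Gamma ((x.1 : ℝ) + (x.2 : ℝ) + δ * κ1 / (ρ * (κ1 + κ2))
        + δ * κ2 / (ρ * (κ1 + κ2)))) *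
    ((κ1 + κ2) / δ) ^ (x.1 + x.2)

/-- Beta-binomial weights. -/
noncomputable def bw (a b : ℝ) (x : ℕ × ℕ) : ℝ :=
  ((x.1 + x.2).factorial : ℝ) / ((x.1.factorial : ℝ) * (x.2.factorial : ℝ)) *
    (Real.Gamma (a + b) / (Real.Gamma a * Real.Gamma b)) *
    (Real.Gamma ((x.1 : ℝ) + a) * Real.Gamma ((x.2 : ℝ) + b) /
      Real.Gamma ((x.1 : ℝ) + (x.2 : ℝ) + a + b))

noncomputable def up1 (a b : ℝ) (y : ℕ × ℕ) : ℝ := ((y.1 : ℝ) + a) / ((y.1 : ℝ) + y.2 + a + b)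
noncomputable def up2 (a b : ℝ) (y : ℕ × ℕ) : ℝ := ((y.2 : ℝ) + b) / ((y.1 : ℝ) + y.2 + a + b)

theorem bw_zero (a b : ℝ) (ha : 0 < a) (hb : 0 < b) : bw a b (0, 0) = 1 := by
  have h1 := (Real.Gamma_pos_of_pos ha).ne'
  have h2 := (Real.Gamma_pos_of_pos hb).ne'
  have h3 := (Real.Gamma_pos_of_pos (add_pos ha hb)).ne'
  simp [bw]
  field_simp

theorem bw_nonneg (a b : ℝ) (ha : 0 < a) (hb : 0 < b) (x : ℕ × ℕ) : 0 ≤ bw a b x := by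
  have h1 := (Real.Gamma_pos_of_pos ha)
  have h2 := (Real.Gamma_pos_of_pos hb)
  have h3 := (Real.Gamma_pos_of_pos (add_pos ha hb))
  have h4 : 0 < Real.Gamma ((x.1 : ℝ) + a) := Real.Gamma_pos_of_pos (by positivity)
  have h5 : 0 < Real.Gamma ((x.2 : ℝ) + b) := Real.Gamma_pos_of_pos (by positivity)
  have h6 : 0 < Real.Gamma ((x.1 : ℝ) + (x.2 : ℝ) + a + b) :=
    Real.Gamma_pos_of_pos (by positivity)
  unfold bw
  positivity

theorem bw_succ1 (a b : ℝ) (ha : 0 < a) (hb : 0 < b) (i j : ℕ) :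
    bw a b (i + 1, j) * ((i : ℝ) + 1) = ((i : ℝ) + j + 1) * (bw a b (i, j) * up1 a b (i, j)) := by
  have h1 := (Real.Gamma_pos_of_pos ha).ne'
  have h2 := (Real.Gamma_pos_of_pos hb).ne'
  have h4 : (i : ℝ) + a ≠ 0 := by positivity
  have h5 : (i : ℝ) + j + a + b ≠ 0 := by positivity
  have h6 : Real.Gamma ((i : ℝ) + j + a + b) ≠ 0 :=
    (Real.Gamma_pos_of_pos (by positivity)).ne'
  have e1 : ((i + 1 : ℕ) : ℝ) + a = ((i : ℝ) + a) + 1 := by push_cast; ring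
  have e2 : ((i + 1 : ℕ) : ℝ) + (j : ℝ) + a + b = ((i : ℝ) + j + a + b) + 1 := by
    push_cast; ring
  have e3 : i + 1 + j = (i + j) + 1 := by ring
  simp only [bw, up1, e1, e2, e3, Real.Gamma_add_one h4, Real.Gamma_add_one h5,
    Nat.factorial_succ]
  push_cast
  field_simp

theorem bw_succ2 (a b : ℝ) (ha : 0 < a) (hb : 0 < b) (i j : ℕ) :
    bw a b (i, j + 1) * ((j : ℝ) + 1) = ((i : ℝ) + j + 1) * (bw a b (i, j) * up2 a b (i, j)) := by
  have h1 := (Real.Gamma_pos_of_pos ha).ne'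
  have h2 := (Real.Gamma_pos_of_pos hb).ne'
  have h4 : (j : ℝ) + b ≠ 0 := by positivity
  have h5 : (i : ℝ) + j + a + b ≠ 0 := by positivity
  have h6 : Real.Gamma ((i : ℝ) + j + a + b) ≠ 0 :=
    (Real.Gamma_pos_of_pos (by positivity)).ne'
  have e1 : ((j + 1 : ℕ) : ℝ) + b = ((j : ℝ) + b) + 1 := by push_cast; ring
  have e2 : (i : ℝ) + ((j + 1 : ℕ) : ℝ) + a + b = ((i : ℝ) + j + a + b) + 1 := by
    push_cast; ring
  have e3 : i + (j + 1) = (i + j) + 1 := by ring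
  simp only [bw, up2, e1, e2, e3, Real.Gamma_add_one h4, Real.Gamma_add_one h5,
    Nat.factorial_succ]
  push_cast
  field_simp

/-- Level sums. -/
noncomputable def lS (a b : ℝ) (n : ℕ) (F : ℕ × ℕ → ℝ) : ℝ :=
  ∑ x ∈ Finset.HasAntidiagonal.antidiagonal n, bw a b x * F x

noncomputable def lU (a b : ℝ) (f : ℕ × ℕ → ℝ) (y : ℕ × ℕ) : ℝ :=
  up1 a b y * f (y.1 + 1, y.2) + up2 a b y * f (y.1, y.2 + 1)

noncomputable def lD (h : ℕ × ℕ → ℝ) (x : ℕ × ℕ) : ℝ :=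
  ((x.1 : ℝ) * h (x.1 - 1, x.2) + (x.2 : ℝ) * h (x.1, x.2 - 1)) / ((x.1 : ℝ) + x.2)

theorem up_add (a b : ℝ) (ha : 0 < a) (hb : 0 < b) (y : ℕ × ℕ) :
    up1 a b y + up2 a b y = 1 := by
  have : (y.1 : ℝ) + y.2 + a + b ≠ 0 := by positivity
  unfold up1 up2
  field_simp
  ring

theorem up1_nonneg (a b : ℝ) (ha : 0 < a) (hb : 0 < b) (y : ℕ × ℕ) : 0 ≤ up1 a b y := by
  unfold up1; positivity
theorem up2_nonneg (a b : ℝ) (ha : 0 < a) (hb : 0 < b) (y : ℕ × ℕ) : 0 ≤ up2 a b y := by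
  unfold up2; positivity

theorem lS_congr (a b : ℝ) (n : ℕ) (F G : ℕ × ℕ → ℝ)
    (h : ∀ i j : ℕ, i + j = n → F (i, j) = G (i, j)) : lS a b n F = lS a b n G := by
  unfold lS
  refine Finset.sum_congr rfl fun x hx => ?_
  rw [Finset.HasAntidiagonal.mem_antidiagonal] at hx
  rw [show F x = G x from h x.1 x.2 hx]

theorem lS_mono (a b : ℝ) (ha : 0 < a) (hb : 0 < b) (n : ℕ) (F G : ℕ × ℕ → ℝ)
    (h : ∀ i j : ℕ, i + j = n → F (i, j) ≤ G (i, j)) : lS a b n F ≤ lS a b n G := by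
  unfold lS
  refine Finset.sum_le_sum fun x hx => ?_
  rw [Finset.HasAntidiagonal.mem_antidiagonal] at hx
  exact mul_le_mul_of_nonneg_left (h x.1 x.2 hx) (bw_nonneg a b ha hb x)

theorem lS_add (a b : ℝ) (n : ℕ) (F G : ℕ × ℕ → ℝ) :
    lS a b n (fun x => F x + G x) = lS a b n F + lS a b n G := by
  simp [lS, mul_add, Finset.sum_add_distrib]

theorem lS_sub (a b : ℝ) (n : ℕ) (F G : ℕ × ℕ → ℝ) :
    lS a b n (fun x => F x - G x) = lS a b n F - lS a b n G := by
  simp [lS, mul_sub, Finset.sum_sub_distrib]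

theorem lS_mul (a b : ℝ) (n : ℕ) (c : ℝ) (F : ℕ × ℕ → ℝ) :
    lS a b n (fun x => c * F x) = c * lS a b n F := by
  simp only [lS, Finset.mul_sum]
  exact Finset.sum_congr rfl fun x _ => by ring

theorem lS_x1 (a b : ℝ) (ha : 0 < a) (hb : 0 < b) (n : ℕ) (F : ℕ × ℕ → ℝ) :
    lS a b (n + 1) (fun x => (x.1 : ℝ) * F x)
      = ((n : ℝ) + 1) * lS a b n (fun y => up1 a b y * F (y.1 + 1, y.2)) := by
  unfold lS
  rw [Finset.Nat.sum_antidiagonal_succ, Finset.mul_sum]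
  simp only [Nat.cast_zero, zero_mul, mul_zero, zero_add]
  refine Finset.sum_congr rfl fun x hx => ?_
  rw [Finset.HasAntidiagonal.mem_antidiagonal] at hx
  have := bw_succ1 a b ha hb x.1 x.2
  have hn : (n : ℝ) = x.1 + x.2 := by rw [← hx]; push_cast; ring
  rw [hn]
  push_cast
  linear_combination F (x.1 + 1, x.2) * this

theorem lS_x2 (a b : ℝ) (ha : 0 < a) (hb : 0 < b) (n : ℕ) (F : ℕ × ℕ → ℝ) :
    lS a b (n + 1) (fun x => (x.2 : ℝ) * F x)
      = ((n : ℝ) + 1) * lS a b n (fun y => up2 a b y * F (y.1, y.2 + 1)) := by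
  unfold lS
  rw [Finset.Nat.sum_antidiagonal_succ', Finset.mul_sum]
  simp only [Nat.cast_zero, zero_mul, mul_zero, zero_add]
  refine Finset.sum_congr rfl fun x hx => ?_
  rw [Finset.HasAntidiagonal.mem_antidiagonal] at hx
  have := bw_succ2 a b ha hb x.1 x.2
  have hn : (n : ℝ) = x.1 + x.2 := by rw [← hx]; push_cast; ring
  rw [hn]
  push_cast
  linear_combination F (x.1, x.2 + 1) * this

theorem lS_adj (a b : ℝ) (ha : 0 < a) (hb : 0 < b) (n : ℕ) (F h : ℕ × ℕ → ℝ) :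
    lS a b (n + 1) (fun x => F x * lD h x) = lS a b n (fun y => lU a b F y * h y) := by
  have hn : ((n : ℝ) + 1) ≠ 0 := by positivity
  apply mul_left_cancel₀ hn
  rw [← lS_mul]
  have e1 : lS a b (n + 1) (fun x => ((n : ℝ) + 1) * (F x * lD h x)) =
      lS a b (n + 1) (fun x => (x.1 : ℝ) * (F x * h (x.1 - 1, x.2))
        + (x.2 : ℝ) * (F x * h (x.1, x.2 - 1))) := by
    apply lS_congr
    intro i j hij
    have : (i : ℝ) + j = n + 1 := by exact_mod_cast hij
    simp only [lD, this]
    field_simp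
  rw [e1, lS_add, lS_x1 a b ha hb n (fun x => F x * h (x.1 - 1, x.2)),
    lS_x2 a b ha hb n (fun x => F x * h (x.1, x.2 - 1)), ← mul_add, ← lS_add]
  congr 1
  apply lS_congr
  intro i j _
  simp only [lU, Nat.add_sub_cancel]
  ring

theorem lS_U (a b : ℝ) (ha : 0 < a) (hb : 0 < b) (n : ℕ) (F : ℕ × ℕ → ℝ) :
    lS a b (n + 1) F = lS a b n (lU a b F) := by
  have := lS_adj a b ha hb n F (fun _ => 1)
  simp only [mul_one] at this
  rw [← this]
  apply lS_congr
  intro i j hij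
  have : (i : ℝ) + j ≠ 0 := by
    have : (i : ℝ) + j = n + 1 := by exact_mod_cast hij
    rw [this]; positivity
  simp [lD, this]

theorem lS_zero (a b : ℝ) (ha : 0 < a) (hb : 0 < b) (F : ℕ × ℕ → ℝ) :
    lS a b 0 F = F (0, 0) := by
  simp [lS, bw_zero a b ha hb]

theorem lS_one (a b : ℝ) (ha : 0 < a) (hb : 0 < b) (n : ℕ) :
    lS a b n (fun _ => 1) = 1 := by
  induction n with
  | zero => simp [lS_zero a b ha hb]
  | succ n ih =>
    rw [lS_U a b ha hb]
    refine Eq.trans ?_ ih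
    apply lS_congr
    intro i j _
    simp [lU, up_add a b ha hb]

theorem lS_D (a b : ℝ) (ha : 0 < a) (hb : 0 < b) (n : ℕ) (F : ℕ × ℕ → ℝ) :
    lS a b (n + 1) (lD F) = lS a b n F := by
  have := lS_adj a b ha hb n (fun _ => 1) F
  simp only [one_mul] at this
  rw [this]
  apply lS_congr
  intro i j _
  simp [lU, up_add a b ha hb]

noncomputable def lA (a b : ℝ) (m : ℕ) (f : ℕ × ℕ → ℝ) : ℝ :=
  lS a b m (fun z => up1 a b z * up2 a b z * (f (z.1 + 1, z.2) - f (z.1, z.2 + 1)) ^ 2)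

theorem lA_eq (a b : ℝ) (ha : 0 < a) (hb : 0 < b) (m : ℕ) (f : ℕ × ℕ → ℝ) :
    lS a b (m + 1) (fun x => f x ^ 2) - lS a b m (fun x => lU a b f x ^ 2) = lA a b m f := by
  rw [lS_U a b ha hb, ← lS_sub, lA]
  apply lS_congr
  intro i j _
  have := up_add a b ha hb (i, j)
  have h2 : up2 a b (i, j) = 1 - up1 a b (i, j) := by linarith
  simp only [lU, h2]
  ring

theorem lB_eq (a b : ℝ) (ha : 0 < a) (hb : 0 < b) (m : ℕ) (h : ℕ × ℕ → ℝ) :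
    ((m : ℝ) + 2) * (m + 1 + a + b) *
      (lS a b (m + 1) (fun x => h x ^ 2) - lS a b (m + 2) (fun x => lD h x ^ 2))
      = ((m : ℝ) + 1) * (m + a + b) * lA a b m h := by
  have hm : (m : ℝ) + 2 ≠ 0 := by positivity
  have hm' : (m : ℝ) + 1 + a + b ≠ 0 := by positivity
  rw [← lS_D a b ha hb (m + 1), ← lS_sub]
  have e1 : lS a b (m + 1 + 1) (fun x => lD (fun x => h x ^ 2) x - lD h x ^ 2) =
      (1 / ((m : ℝ) + 2) ^ 2) * lS a b (m + 1 + 1) (fun x => (x.1 : ℝ) * ((x.2 : ℝ) *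
        (h (x.1 - 1, x.2) - h (x.1, x.2 - 1)) ^ 2)) := by
    rw [← lS_mul]
    apply lS_congr
    intro i j hij
    have h1 : (i : ℝ) + j = m + 2 := by
      have : (i : ℝ) + j = m + 1 + 1 := by exact_mod_cast hij
      linarith
    have h2 : (i : ℝ) = m + 2 - j := by linarith
    simp only [lD, h1]
    field_simp
    rw [h2]
    ring
  rw [e1, lS_x1 a b ha hb (m + 1) (fun x => (x.2 : ℝ) * (h (x.1 - 1, x.2) - h (x.1, x.2 - 1)) ^ 2)]
  have e2 : lS a b (m + 1) (fun y => up1 a b y * ((y.2 : ℝ) *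
      (h (y.1 + 1 - 1, y.2) - h (y.1 + 1, y.2 - 1)) ^ 2))
      = lS a b (m + 1) (fun y => (y.2 : ℝ) * (up1 a b y *
      (h (y.1 + 1 - 1, y.2) - h (y.1 + 1, y.2 - 1)) ^ 2)) := by
    apply lS_congr
    intro i j _
    ring
  rw [e2, lS_x2 a b ha hb m (fun y => up1 a b y *
      (h (y.1 + 1 - 1, y.2) - h (y.1 + 1, y.2 - 1)) ^ 2)]
  have e3 : lS a b m (fun y => up2 a b y * (up1 a b (y.1, y.2 + 1) *
      (h (y.1 + 1 - 1, y.2 + 1) - h (y.1 + 1, y.2 + 1 - 1)) ^ 2))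
      = ((m : ℝ) + a + b) / (m + 1 + a + b) * lA a b m h := by
    rw [lA, ← lS_mul]
    apply lS_congr
    intro i j hij
    have h1 : (m : ℝ) = i + j := by rw [← hij]; push_cast; ring
    have h3 : (i : ℝ) + j + a + b ≠ 0 := by positivity
    have h4 : (i : ℝ) + j + 1 + a + b ≠ 0 := by positivity
    have h5 : (i : ℝ) + (j + 1) + a + b = (i : ℝ) + j + 1 + a + b := by ring
    simp only [up1, up2, h1, Nat.add_sub_cancel]
    push_cast
    rw [h5]
    field_simp
    ring
  rw [e3]
  push_cast
  have h6 : (m : ℝ) + 1 + 1 = m + 2 := by ring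
  rw [h6]
  field_simp

/-- Spectral gap of the Moran model, mean-zero version. -/
theorem gap0 (a b : ℝ) (ha : 0 < a) (hb : 0 < b) (m : ℕ) : ∀ f : ℕ × ℕ → ℝ,
    lS a b (m + 1) f = 0 →
    (a + b) * lS a b (m + 1) (fun x => f x ^ 2) ≤ ((m : ℝ) + 1) * (m + a + b) * lA a b m f := by
  induction m with
  | zero =>
    intro f hf
    have h1 := lA_eq a b ha hb 0 f
    rw [lS_U a b ha hb, lS_zero a b ha hb] at hf
    rw [lS_zero a b ha hb (fun x => lU a b f x ^ 2)] at h1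
    simp only [hf] at h1
    rw [← h1]
    simp
  | succ m ih =>
    intro f hf
    have hA := lA_eq a b ha hb (m + 1) f
    have hB := lB_eq a b ha hb m (lU a b f)
    have hm0 : lS a b (m + 1) (lU a b f) = 0 := by rw [← lS_U a b ha hb]; exact hf
    have hI := ih _ hm0
    have hadj := lS_adj a b ha hb (m + 1) f (lU a b f)
    rw [← hA]
    rw [← hB] at hI
    have hK : 0 < ((m : ℝ) + 2) * (m + 1 + a + b) := by positivity
    have hKg : a + b < ((m : ℝ) + 2) * (m + 1 + a + b) := by
      have : (0 : ℝ) ≤ m := by positivity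
      nlinarith [mul_nonneg this this, mul_nonneg this ha.le, mul_nonneg this hb.le]
    have e : lS a b (m + 1) (fun x => lU a b f x * lU a b f x)
        = lS a b (m + 1) (fun x => lU a b f x ^ 2) := by
      apply lS_congr; intro i j _; ring
    rw [e] at hadj
    set K := ((m : ℝ) + 2) * (m + 1 + a + b) with hKdef
    have hK' : (((m + 1 : ℕ) : ℝ) + 1) * (((m + 1 : ℕ) : ℝ) + a + b) = K := by
      rw [hKdef]; push_cast; ring
    rw [hK']
    have hsq : 0 ≤ lS a b (m + 1 + 1) (fun x => ((K - (a + b)) * f x - K * lD (lU a b f) x) ^ 2) := by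
      have := lS_mono a b ha hb (m + 1 + 1) (fun _ => 0)
        (fun x => ((K - (a + b)) * f x - K * lD (lU a b f) x) ^ 2)
        (fun i j _ => sq_nonneg _)
      simpa [lS] using this
    have hex : lS a b (m + 1 + 1) (fun x => ((K - (a + b)) * f x - K * lD (lU a b f) x) ^ 2)
        = (K - (a + b)) ^ 2 * lS a b (m + 1 + 1) (fun x => f x ^ 2)
          - 2 * (K - (a + b)) * K * lS a b (m + 1 + 1) (fun x => f x * lD (lU a b f) x)
          + K ^ 2 * lS a b (m + 1 + 1) (fun x => lD (lU a b f) x ^ 2) := by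
      rw [← lS_mul, ← lS_mul, ← lS_mul, ← lS_sub, ← lS_add]
      apply lS_congr; intro i j _; ring
    rw [hex, hadj] at hsq
    change (a + b) * _ ≤ K * (_ - lS a b (m + 1 + 1) (fun x => lD (lU a b f) x ^ 2)) at hI
    generalize lS a b (m + 1 + 1) (fun x => lD (lU a b f) x ^ 2) = d at *
    generalize lS a b (m + 1 + 1) (fun x => f x ^ 2) = s at *
    generalize lS a b (m + 1) (fun x => lU a b f x ^ 2) = t at *
    have h1 : K * ((a + b) * t) ≤ K * (K * (t - d)) := mul_le_mul_of_nonneg_left hI hK.le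
    have h2 : 0 ≤ (K - (a + b)) * ((K - (a + b)) * s - K * t) := by
      have r1 : (K - (a + b)) * ((K - (a + b)) * s - K * t)
          = ((K - (a + b)) ^ 2 * s - 2 * (K - (a + b)) * K * t + K ^ 2 * d)
            + (K * (K * (t - d)) - K * ((a + b) * t)) := by ring
      rw [r1]
      linarith
    have h3 : 0 ≤ (K - (a + b)) * s - K * t :=
      nonneg_of_mul_nonneg_right h2 (by linarith)
    linarith

theorem gap (a b : ℝ) (ha : 0 < a) (hb : 0 < b) (m : ℕ) (f : ℕ × ℕ → ℝ) :
    (a + b) * (lS a b (m + 1) (fun x => f x ^ 2) - lS a b (m + 1) f ^ 2)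
      ≤ ((m : ℝ) + 1) * (m + a + b) * lA a b m f := by
  set c := lS a b (m + 1) f with hc
  have e : lS a b (m + 1) (fun x => f x - c * 1) = 0 := by
    rw [lS_sub, lS_mul, lS_one a b ha hb]; linarith
  have h := gap0 a b ha hb m _ e
  have e2 : lS a b (m + 1) (fun x => (f x - c * 1) ^ 2)
      = lS a b (m + 1) (fun x => f x ^ 2) - c ^ 2 := by
    have : lS a b (m + 1) (fun x => (f x - c * 1) ^ 2)
        = lS a b (m + 1) (fun x => f x ^ 2) - 2 * c * lS a b (m + 1) f
          + c ^ 2 * lS a b (m + 1) (fun _ => 1) := by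
      rw [← lS_mul a b (m + 1) (2 * c) f, ← lS_mul a b (m + 1) (c ^ 2) (fun _ => 1),
        ← lS_sub, ← lS_add]
      apply lS_congr; intro i j _; ring
    rw [this, lS_one a b ha hb, ← hc]; ring
  rw [e2] at h
  have e3 : lA a b m (fun x => f x - c * 1) = lA a b m f := by
    unfold lA
    apply lS_congr; intro i j _; ring
  rw [e3] at h
  exact h

theorem lS_sq_le (a b : ℝ) (ha : 0 < a) (hb : 0 < b) (n : ℕ) (f : ℕ × ℕ → ℝ) :
    lS a b n f ^ 2 ≤ lS a b n (fun x => f x ^ 2) := by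
  generalize hc : lS a b n f = c
  have e2 : lS a b n (fun x => (f x - c) ^ 2)
        = lS a b n (fun x => f x ^ 2) - 2 * c * lS a b n f
          + c ^ 2 * lS a b n (fun _ => 1) := by
    rw [← lS_mul a b n (2 * c) f, ← lS_mul a b n (c ^ 2) (fun _ => 1), ← lS_sub, ← lS_add]
    apply lS_congr; intro i j _; ring
  have h0 : 0 ≤ lS a b n (fun x => (f x - c) ^ 2) := by
    have := lS_mono a b ha hb n (fun _ => 0) (fun x => (f x - c) ^ 2)
        (fun i j _ => sq_nonneg _)
    simpa [lS] using this
  rw [e2, lS_one a b ha hb, hc] at h0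
  linarith

noncomputable def lE (a b : ℝ) (f : ℕ × ℕ → ℝ) (y : ℕ × ℕ) : ℝ :=
  up1 a b y * (f (y.1 + 1, y.2) - f y) ^ 2 + up2 a b y * (f (y.1, y.2 + 1) - f y) ^ 2

theorem lE_nonneg (a b : ℝ) (ha : 0 < a) (hb : 0 < b) (f : ℕ × ℕ → ℝ) (y : ℕ × ℕ) :
    0 ≤ lE a b f y := by
  have := up1_nonneg a b ha hb y
  have := up2_nonneg a b ha hb y
  unfold lE
  positivity

theorem mean_step (a b : ℝ) (ha : 0 < a) (hb : 0 < b) (n : ℕ) (f : ℕ × ℕ → ℝ) :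
    (lS a b (n + 1) f - lS a b n f) ^ 2 ≤ lS a b n (lE a b f) := by
  rw [lS_U a b ha hb, ← lS_sub]
  refine (lS_sq_le a b ha hb n _).trans (lS_mono a b ha hb n _ _ ?_)
  intro i j _
  have h := up_add a b ha hb (i, j)
  have h1 := up1_nonneg a b ha hb (i, j)
  have h2 := up2_nonneg a b ha hb (i, j)
  simp only [lU, lE]
  generalize f (i + 1, j) = u
  generalize f (i, j + 1) = v
  generalize f (i, j) = w
  generalize up1 a b (i, j) = p at *
  generalize up2 a b (i, j) = q at *
  obtain rfl : q = 1 - p := by linarith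
  have := mul_nonneg (mul_nonneg h1 h2) (sq_nonneg (u - v))
  have r : p * (u - w) ^ 2 + (1 - p) * (v - w) ^ 2 - (p * u + (1 - p) * v - w) ^ 2
      = p * (1 - p) * (u - v) ^ 2 := by ring
  linarith

theorem mean_bound (a b : ℝ) (ha : 0 < a) (hb : 0 < b) (f : ℕ × ℕ → ℝ) (h0 : f (0, 0) = 0)
    (n : ℕ) :
    lS a b n f ^ 2 ≤ (n : ℝ) * ∑ k ∈ Finset.range n, lS a b k (lE a b f) := by
  have h := Finset.sum_range_sub (fun k => lS a b k f) n
  rw [lS_zero a b ha hb, h0, sub_zero] at h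
  rw [← h]
  refine (sq_sum_le_card_mul_sum_sq).trans ?_
  rw [Finset.card_range]
  refine mul_le_mul_of_nonneg_left (Finset.sum_le_sum fun k _ => ?_) (by positivity)
  exact mean_step a b ha hb k f

noncomputable def pw (L : ℝ) (n : ℕ) : ℝ := Real.exp (-L) * (L ^ n / (n.factorial : ℝ))

theorem pw_nonneg (L : ℝ) (hL : 0 < L) (n : ℕ) : 0 ≤ pw L n := by
  unfold pw; positivity

theorem pw_succ (L : ℝ) (n : ℕ) : pw L (n + 1) * ((n : ℝ) + 1) = L * pw L n := by
  unfold pw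
  rw [Nat.factorial_succ]
  push_cast
  field_simp
  ring

theorem pw_add_le (L : ℝ) (hL : 0 < L) (k j : ℕ) :
    pw L (k + j) ≤ pw L k * (L ^ j / (j.factorial : ℝ)) := by
  have h : ((k.factorial * j.factorial : ℕ) : ℝ) ≤ ((k + j).factorial : ℕ) := by
    exact_mod_cast Nat.le_of_dvd (Nat.factorial_pos _) (Nat.factorial_mul_factorial_dvd_factorial_add k j)
  push_cast at h
  unfold pw
  rw [mul_assoc, div_mul_div_comm, ← pow_add]
  gcongr

theorem pw_tail (L : ℝ) (hL : 0 < L) (k N : ℕ) :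
    ∑ m ∈ Finset.Ico k N, pw L m ≤ Real.exp L * pw L k := by
  rw [Finset.sum_Ico_eq_sum_range]
  calc _ ≤ ∑ j ∈ Finset.range (N - k), pw L k * (L ^ j / (j.factorial : ℝ)) :=
        Finset.sum_le_sum fun j _ => pw_add_le L hL k j
    _ = pw L k * ∑ j ∈ Finset.range (N - k), (L ^ j / (j.factorial : ℝ)) := by
        rw [Finset.mul_sum]
    _ ≤ pw L k * Real.exp L :=
        mul_le_mul_of_nonneg_left (Real.sum_le_exp_of_nonneg hL.le _) (pw_nonneg L hL k)
    _ = _ := mul_comm _ _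

theorem pw_double (L : ℝ) (hL : 0 < L) (d : ℕ → ℝ) (hd : ∀ k, 0 ≤ d k) (N : ℕ) :
    ∑ m ∈ Finset.range N, pw L m * ∑ k ∈ Finset.range (m + 1), d k
      ≤ Real.exp L * ∑ k ∈ Finset.range N, pw L k * d k := by
  have h := Finset.sum_Ico_Ico_comm 0 N (fun i j => pw L j * d i)
  simp only [Finset.range_eq_Ico, Finset.mul_sum]
  rw [← h]
  refine Finset.sum_le_sum fun k _ => ?_
  rw [← Finset.sum_mul, ← mul_assoc]
  exact mul_le_mul_of_nonneg_right (pw_tail L hL k N) (hd k)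

/-- exchange energy density -/
noncomputable def lX (a b : ℝ) (f : ℕ × ℕ → ℝ) (y : ℕ × ℕ) : ℝ :=
  ((y.1 : ℝ) * up2 a b y + (y.2 : ℝ) * up1 a b y) * (f (y.1 + 1, y.2) - f (y.1, y.2 + 1)) ^ 2

theorem lX_nonneg (a b : ℝ) (ha : 0 < a) (hb : 0 < b) (f : ℕ × ℕ → ℝ) (y : ℕ × ℕ) :
    0 ≤ lX a b f y := by
  have := up1_nonneg a b ha hb y
  have := up2_nonneg a b ha hb y
  unfold lX
  positivity

theorem A_le (a b : ℝ) (ha : 0 < a) (hb : 0 < b) (m : ℕ) (f : ℕ × ℕ → ℝ) :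
    ((m : ℝ) + a + b) * lA a b m f
      ≤ lS a b m (fun z => (1 + a + b) * lX a b f z + 2 * (a + b) * lE a b f z) := by
  unfold lA
  rw [← lS_mul]
  apply lS_mono a b ha hb
  intro i j hij
  have hm : (m : ℝ) = i + j := by rw [← hij]; push_cast; ring
  have hs : (i : ℝ) + j + a + b ≠ 0 := by positivity
  have h1 : ((i : ℝ) + j + a + b) * up1 a b (i, j) = i + a := by
    simp only [up1]; field_simp
  have h2 : ((i : ℝ) + j + a + b) * up2 a b (i, j) = j + b := by
    simp only [up2]; field_simp
  have hX := lX_nonneg a b ha hb f (i, j)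
  have hE := lE_nonneg a b ha hb f (i, j)
  have p1 := up1_nonneg a b ha hb (i, j)
  have p2 := up2_nonneg a b ha hb (i, j)
  have h := up_add a b ha hb (i, j)
  rw [hm]
  simp only [lX, lE] at *
  have hD := sq_nonneg (f (i + 1, j) - f (i, j + 1))
  rcases Nat.eq_zero_or_pos i with hi | hi
  · rcases Nat.eq_zero_or_pos j with hj | hj
    · subst hi hj
      simp only [Nat.cast_zero, zero_add, zero_mul, mul_zero] at *
      generalize f (1, 0) = u at *
      generalize f (0, 1) = v at *
      generalize f (0, 0) = w at *
      generalize up1 a b (0, 0) = p at *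
      generalize up2 a b (0, 0) = q at *
      have k1 : (u - v) ^ 2 ≤ 2 * (u - w) ^ 2 + 2 * (v - w) ^ 2 := by
        nlinarith [sq_nonneg (u - w + (v - w))]
      have k2 : p * q * (u - v) ^ 2 ≤ 2 * (p * (u - w) ^ 2 + q * (v - w) ^ 2) := by
        have hp : p * q ≤ p := mul_le_of_le_one_right p1 (by linarith)
        have hq : p * q ≤ q := mul_le_of_le_one_left p2 (by linarith)
        have s1 := mul_le_mul_of_nonneg_right hp (sq_nonneg (u - w))
        have s2 := mul_le_mul_of_nonneg_right hq (sq_nonneg (v - w))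
        have s3 := mul_le_mul_of_nonneg_left k1 (mul_nonneg p1 p2)
        linarith
      have := mul_le_mul_of_nonneg_left k2 (add_pos ha hb).le
      linarith
    · have hj' : (1 : ℝ) ≤ j := by exact_mod_cast hj
      have k : ((i : ℝ) + j + a + b) * (up1 a b (i, j) * up2 a b (i, j) *
          (f (i + 1, j) - f (i, j + 1)) ^ 2) ≤ (1 + a + b) *
          (((i : ℝ) * up2 a b (i, j) + (j : ℝ) * up1 a b (i, j)) *
          (f (i + 1, j) - f (i, j + 1)) ^ 2) := by
        rw [← mul_assoc ((i : ℝ) + j + a + b), ← mul_assoc (1 + a + b)]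
        refine mul_le_mul_of_nonneg_right ?_ hD
        have e : ((i : ℝ) + j + a + b) * (up1 a b (i, j) * up2 a b (i, j))
            = (j + b) * up1 a b (i, j) := by rw [← h2]; ring
        rw [e]
        have q1 : (j : ℝ) + b ≤ (1 + a + b) * j := by nlinarith
        have q2 := mul_le_mul_of_nonneg_right q1 p1
        have q3 : 0 ≤ (1 + a + b) * ((i : ℝ) * up2 a b (i, j)) := by positivity
        linarith
      have : 0 ≤ 2 * (a + b) * (up1 a b (i, j) * (f (i + 1, j) - f (i, j)) ^ 2
        + up2 a b (i, j) * (f (i, j + 1) - f (i, j)) ^ 2) := by positivity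
      linarith
  · have hi' : (1 : ℝ) ≤ i := by exact_mod_cast hi
    have k : ((i : ℝ) + j + a + b) * (up1 a b (i, j) * up2 a b (i, j) *
        (f (i + 1, j) - f (i, j + 1)) ^ 2) ≤ (1 + a + b) *
        (((i : ℝ) * up2 a b (i, j) + (j : ℝ) * up1 a b (i, j)) *
        (f (i + 1, j) - f (i, j + 1)) ^ 2) := by
      rw [← mul_assoc ((i : ℝ) + j + a + b), ← mul_assoc (1 + a + b)]
      refine mul_le_mul_of_nonneg_right ?_ hD
      have e : ((i : ℝ) + j + a + b) * (up1 a b (i, j) * up2 a b (i, j))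
          = (i + a) * up2 a b (i, j) := by rw [← h1]; ring
      rw [e]
      have q1 : (i : ℝ) + a ≤ (1 + a + b) * i := by nlinarith
      have q2 := mul_le_mul_of_nonneg_right q1 p2
      have q3 : 0 ≤ (1 + a + b) * ((j : ℝ) * up1 a b (i, j)) := by positivity
      linarith
    have : 0 ≤ 2 * (a + b) * (up1 a b (i, j) * (f (i + 1, j) - f (i, j)) ^ 2
      + up2 a b (i, j) * (f (i, j + 1) - f (i, j)) ^ 2) := by positivity
    linarith

/-- Truncated Poincare inequality. -/
theorem trunc (a b L : ℝ) (ha : 0 < a) (hb : 0 < b) (hL : 0 < L) (f : ℕ × ℕ → ℝ)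
    (h0 : f (0, 0) = 0) (N : ℕ) :
    ∑ n ∈ Finset.range (N + 1), pw L n * lS a b n (fun x => f x ^ 2)
      ≤ ∑ n ∈ Finset.range N, pw L n * lS a b n (fun z =>
        L * (1 + a + b) / (a + b) * lX a b f z + (2 * L + L * Real.exp L) * lE a b f z) := by
  rw [Finset.sum_range_succ', lS_zero a b ha hb, h0]
  have hab : 0 < a + b := add_pos ha hb
  have hE : ∀ k, 0 ≤ lS a b k (lE a b f) := fun k =>
    Finset.sum_nonneg fun x _ => mul_nonneg (bw_nonneg a b ha hb x) (lE_nonneg a b ha hb f x)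
  have step : ∀ m : ℕ, pw L (m + 1) * lS a b (m + 1) (fun x => f x ^ 2)
      ≤ pw L m * (L * (1 + a + b) / (a + b) * lS a b m (lX a b f)
          + 2 * L * lS a b m (lE a b f))
        + L * (pw L m * ∑ k ∈ Finset.range (m + 1), lS a b k (lE a b f)) := by
    intro m
    have g := gap a b ha hb m f
    have mb := mean_bound a b ha hb f h0 (m + 1)
    have al := A_le a b ha hb m f
    rw [lS_add, lS_mul, lS_mul] at al
    have ps := pw_succ L m
    have p1 := pw_nonneg L hL (m + 1)
    have p0 := pw_nonneg L hL m
    generalize lS a b (m + 1) (fun x => f x ^ 2) = s at *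
    generalize lS a b m (lX a b f) = X at *
    generalize (∑ k ∈ Finset.range (m + 1), lS a b k (lE a b f)) = T at *
    generalize lS a b m (lE a b f) = E at *
    push_cast at mb
    have g1 : s - lS a b (m + 1) f ^ 2 ≤
        ((m : ℝ) + 1) * (((1 + a + b) * X + 2 * (a + b) * E) / (a + b)) := by
      rw [← mul_div_assoc, le_div_iff₀ hab]
      have := mul_le_mul_of_nonneg_left al (show (0 : ℝ) ≤ (m : ℝ) + 1 by positivity)
      linarith
    have g2 : s ≤ ((m : ℝ) + 1) * (((1 + a + b) * X + 2 * (a + b) * E) / (a + b) + T) := by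
      linarith
    have g3 := mul_le_mul_of_nonneg_left g2 p1
    rw [← mul_assoc, ps] at g3
    refine g3.trans (le_of_eq ?_)
    field_simp
  have hs := Finset.sum_le_sum (s := Finset.range N) fun m _ => step m
  rw [Finset.sum_add_distrib, ← Finset.mul_sum (a := L)] at hs
  have hd := pw_double L hL (fun k => lS a b k (lE a b f)) hE N
  have hd' := mul_le_mul_of_nonneg_left hd hL.le
  have e : ∑ n ∈ Finset.range N, pw L n * lS a b n (fun z =>
        L * (1 + a + b) / (a + b) * lX a b f z + (2 * L + L * Real.exp L) * lE a b f z)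
      = ∑ m ∈ Finset.range N, pw L m * (L * (1 + a + b) / (a + b) * lS a b m (lX a b f)
          + 2 * L * lS a b m (lE a b f))
        + L * (Real.exp L * ∑ k ∈ Finset.range N, pw L k * lS a b k (lE a b f)) := by
    rw [Finset.mul_sum, Finset.mul_sum, ← Finset.sum_add_distrib]
    refine Finset.sum_congr rfl fun n _ => ?_
    rw [lS_add, lS_mul, lS_mul]
    ring
  rw [e]
  simp only [ne_eq, OfNat.ofNat_ne_zero, not_false_eq_true, zero_pow, mul_zero, add_zero]
  linarith

theorem tsum_antidiag (g : ℕ × ℕ → ℝ≥0∞) :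
    ∑' x, g x = ∑' n, ∑ x ∈ Finset.HasAntidiagonal.antidiagonal n, g x := by
  rw [← (Finset.HasAntidiagonal.sigmaAntidiagonalEquivProd (A := ℕ)).tsum_eq, ENNReal.tsum_sigma']
  refine tsum_congr fun n => ?_
  rw [tsum_fintype]
  simp only [Finset.HasAntidiagonal.sigmaAntidiagonalEquivProd_apply]
  exact Finset.sum_coe_sort (Finset.HasAntidiagonal.antidiagonal n) g

noncomputable def PP (a b L : ℝ) (x : ℕ × ℕ) : ℝ := pw L (x.1 + x.2) * bw a b x

theorem PP_nonneg (a b L : ℝ) (ha : 0 < a) (hb : 0 < b) (hL : 0 < L) (x : ℕ × ℕ) :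
    0 ≤ PP a b L x := mul_nonneg (pw_nonneg L hL _) (bw_nonneg a b ha hb x)

theorem PP_succ1 (a b L : ℝ) (ha : 0 < a) (hb : 0 < b) (i j : ℕ) :
    PP a b L (i + 1, j) * ((i : ℝ) + 1) = L * (PP a b L (i, j) * up1 a b (i, j)) := by
  have h1 := bw_succ1 a b ha hb i j
  have h2 := pw_succ L (i + j)
  push_cast at h2
  simp only [PP]
  rw [show i + 1 + j = i + j + 1 by ring]
  linear_combination pw L (i + j + 1) * h1 + bw a b (i, j) * up1 a b (i, j) * h2

theorem PP_succ2 (a b L : ℝ) (ha : 0 < a) (hb : 0 < b) (i j : ℕ) :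
    PP a b L (i, j + 1) * ((j : ℝ) + 1) = L * (PP a b L (i, j) * up2 a b (i, j)) := by
  have h1 := bw_succ2 a b ha hb i j
  have h2 := pw_succ L (i + j)
  push_cast at h2
  simp only [PP]
  rw [show i + (j + 1) = i + j + 1 by ring]
  linear_combination pw L (i + j + 1) * h1 + bw a b (i, j) * up2 a b (i, j) * h2

theorem PP_level (a b L : ℝ) (F : ℕ × ℕ → ℝ) (n : ℕ) :
    ∑ x ∈ Finset.HasAntidiagonal.antidiagonal n, PP a b L x * F x = pw L n * lS a b n F := by
  unfold lS
  rw [Finset.mul_sum]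
  refine Finset.sum_congr rfl fun x hx => ?_
  rw [Finset.HasAntidiagonal.mem_antidiagonal] at hx
  rw [PP, hx, mul_assoc]

theorem PP_tsum (a b L : ℝ) (ha : 0 < a) (hb : 0 < b) (hL : 0 < L) :
    HasSum (PP a b L) 1 := by
  have hp : HasSum (pw L) 1 := by
    have h := (NormedSpace.expSeries_div_hasSum_exp (𝔸 := ℝ) L).mul_left (Real.exp (-L))
    rw [← Real.exp_eq_exp_ℝ, ← Real.exp_add] at h
    rw [neg_add_cancel, Real.exp_zero] at h
    exact h
  have h : ∑' x, ENNReal.ofReal (PP a b L x) = 1 := by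
    rw [tsum_antidiag]
    have : ∀ n, ∑ x ∈ Finset.HasAntidiagonal.antidiagonal n, ENNReal.ofReal (PP a b L x)
        = ENNReal.ofReal (pw L n) := by
      intro n
      rw [← ENNReal.ofReal_sum_of_nonneg fun x _ => PP_nonneg a b L ha hb hL x]
      have := PP_level a b L (fun _ => 1) n
      rw [lS_one a b ha hb] at this
      simp only [mul_one] at this
      rw [this]
    simp only [this]
    rw [← ENNReal.ofReal_tsum_of_nonneg (pw_nonneg L hL) hp.summable, hp.tsum_eq]
    simp
  have hs : Summable (PP a b L) := by
    have := ENNReal.summable_toReal (f := fun x => ENNReal.ofReal (PP a b L x)) (by rw [h]; simp)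
    simpa [ENNReal.toReal_ofReal, PP_nonneg a b L ha hb hL] using this
  have h2 := ENNReal.ofReal_tsum_of_nonneg (PP_nonneg a b L ha hb hL) hs
  rw [h, ENNReal.ofReal_eq_one] at h2
  rw [← h2]
  exact hs.hasSum

theorem piAuto_eq (κ1 κ2 δ ρ : ℝ) : piAuto κ1 κ2 δ ρ =
    PP (δ * κ1 / (ρ * (κ1 + κ2))) (δ * κ2 / (ρ * (κ1 + κ2))) ((κ1 + κ2) / δ) := by
  funext x
  simp only [piAuto, PP, pw, bw]
  generalize δ * κ1 / (ρ * (κ1 + κ2)) = a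
  generalize δ * κ2 / (ρ * (κ1 + κ2)) = b
  generalize (κ1 + κ2) / δ = L
  generalize Real.Gamma ((x.1 : ℝ) + (x.2 : ℝ) + a + b) = g
  generalize Real.Gamma ((x.1 : ℝ) + a) = g1
  generalize Real.Gamma ((x.2 : ℝ) + b) = g2
  have : ((x.1 + x.2).factorial : ℝ) ≠ 0 := by positivity
  field_simp

/-- variance is at most the second moment of `f - c` -/
theorem var_le (P f : ℕ × ℕ → ℝ) (hP : HasSum P 1) (hP0 : ∀ x, 0 ≤ P x) (K c : ℝ)
    (hf : ∀ x, |f x| ≤ K) :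
    Summable (fun x => P x * (f x - c) ^ 2) ∧
      varPi P f ≤ ∑' x, P x * (f x - c) ^ 2 := by
  have s1 : Summable (fun x => f x * P x) := by
    refine Summable.of_norm_bounded (g := fun x => K * P x) (hP.summable.mul_left K) fun x => ?_
    rw [Real.norm_eq_abs, abs_mul, abs_of_nonneg (hP0 x)]
    exact mul_le_mul_of_nonneg_right (hf x) (hP0 x)
  have s2 : Summable (fun x => f x ^ 2 * P x) := by
    refine Summable.of_norm_bounded (g := fun x => K ^ 2 * P x)
      (hP.summable.mul_left (K ^ 2)) fun x => ?_
    rw [Real.norm_eq_abs, abs_mul, abs_of_nonneg (hP0 x), abs_pow]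
    exact mul_le_mul_of_nonneg_right (pow_le_pow_left₀ (abs_nonneg _) (hf x) 2) (hP0 x)
  have hs := ((s2.hasSum.sub (s1.hasSum.mul_left (2 * c))).add (hP.mul_left (c ^ 2)))
  have e : (fun x => f x ^ 2 * P x - 2 * c * (f x * P x) + c ^ 2 * P x)
      = fun x => P x * (f x - c) ^ 2 := by
    funext x; ring
  rw [e] at hs
  refine ⟨hs.summable, ?_⟩
  rw [hs.tsum_eq, varPi]
  nlinarith [sq_nonneg ((∑' x, f x * P x) - c)]

theorem energy (κ1 κ2 δ ρ a b L : ℝ) (ha : 0 < a) (hb : 0 < b) (hL : 0 < L)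
    (hδ : 0 < δ) (hρ : 0 < ρ) (f : ℕ × ℕ → ℝ) (c d : ℝ) (hc : 0 ≤ c) (hd : 0 ≤ d) :
    ∑' z, ENNReal.ofReal (PP a b L z * (c * lX a b f z + d * lE a b f z))
      ≤ ENNReal.ofReal (2 * (c / (ρ * L) + d / (δ * L))) *
        ∑' p : (ℕ × ℕ) × (ℕ × ℕ), ENNReal.ofReal ((f p.1 - f p.2) ^ 2 * PP a b L p.1 *
          qAuto κ1 κ2 δ ρ p.1 p.2) := by
  set T : (ℕ × ℕ) × (ℕ × ℕ) → ℝ≥0∞ := fun p => ENNReal.ofReal ((f p.1 - f p.2) ^ 2 *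
    PP a b L p.1 * qAuto κ1 κ2 δ ρ p.1 p.2) with hT
  have i1 : Function.Injective (fun z : ℕ × ℕ => (((z.1 + 1, z.2), z) : (ℕ × ℕ) × (ℕ × ℕ))) := by
    intro x y h; simp only [Prod.mk.injEq] at h; exact h.2
  have i2 : Function.Injective (fun z : ℕ × ℕ => (((z.1, z.2 + 1), z) : (ℕ × ℕ) × (ℕ × ℕ))) := by
    intro x y h; simp only [Prod.mk.injEq] at h; exact h.2
  have i3 : Function.Injective
      (fun z : ℕ × ℕ => (((z.1, z.2 + 1), (z.1 + 1, z.2)) : (ℕ × ℕ) × (ℕ × ℕ))) := by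
    intro x y h; simp only [Prod.mk.injEq] at h; exact Prod.ext h.1.1 h.2.2
  have i4 : Function.Injective
      (fun z : ℕ × ℕ => (((z.1 + 1, z.2), (z.1, z.2 + 1)) : (ℕ × ℕ) × (ℕ × ℕ))) := by
    intro x y h; simp only [Prod.mk.injEq] at h; exact Prod.ext h.2.1 h.1.2
  have t1 := ENNReal.tsum_comp_le_tsum_of_injective i1 T
  have t2 := ENNReal.tsum_comp_le_tsum_of_injective i2 T
  have t3 := ENNReal.tsum_comp_le_tsum_of_injective i3 T
  have t4 := ENNReal.tsum_comp_le_tsum_of_injective i4 T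
  have key : ∀ z : ℕ × ℕ, ENNReal.ofReal (PP a b L z * (c * lX a b f z + d * lE a b f z))
      ≤ ENNReal.ofReal (d / (δ * L)) * (T ((z.1 + 1, z.2), z) + T ((z.1, z.2 + 1), z))
        + ENNReal.ofReal (c / (ρ * L)) *
          (T ((z.1, z.2 + 1), (z.1 + 1, z.2)) + T ((z.1 + 1, z.2), (z.1, z.2 + 1))) := by
    rintro ⟨i, j⟩
    have p1 := PP_succ1 a b L ha hb i j
    have p2 := PP_succ2 a b L ha hb i j
    have q1 : qAuto κ1 κ2 δ ρ (i + 1, j) (i, j) = δ * ((i : ℝ) + 1) := by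
      simp [qAuto]
      omega
    have q2 : qAuto κ1 κ2 δ ρ (i, j + 1) (i, j) = δ * ((j : ℝ) + 1) := by
      simp [qAuto]
      omega
    have q3 : qAuto κ1 κ2 δ ρ (i, j + 1) (i + 1, j) = ρ * i * ((j : ℝ) + 1) := by
      simp [qAuto]
    have q4 : qAuto κ1 κ2 δ ρ (i + 1, j) (i, j + 1) = ρ * ((i : ℝ) + 1) * j := by
      simp [qAuto]
    have P0 := PP_nonneg a b L ha hb hL (i, j)
    have P1 := PP_nonneg a b L ha hb hL (i + 1, j)
    have P2 := PP_nonneg a b L ha hb hL (i, j + 1)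
    simp only [hT, q1, q2, q3, q4]
    rw [← ENNReal.ofReal_add (by positivity) (by positivity),
      ← ENNReal.ofReal_add (by positivity) (by positivity),
      ← ENNReal.ofReal_mul (by positivity), ← ENNReal.ofReal_mul (by positivity),
      ← ENNReal.ofReal_add (by positivity) (by positivity)]
    apply ENNReal.ofReal_le_ofReal
    apply le_of_eq
    have e1 : (f (i + 1, j) - f (i, j)) ^ 2 * PP a b L (i + 1, j) * (δ * ((i : ℝ) + 1))
        = (δ * L) * (PP a b L (i, j) * (up1 a b (i, j) * (f (i + 1, j) - f (i, j)) ^ 2)) := by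
      linear_combination δ * (f (i + 1, j) - f (i, j)) ^ 2 * p1
    have e2 : (f (i, j + 1) - f (i, j)) ^ 2 * PP a b L (i, j + 1) * (δ * ((j : ℝ) + 1))
        = (δ * L) * (PP a b L (i, j) * (up2 a b (i, j) * (f (i, j + 1) - f (i, j)) ^ 2)) := by
      linear_combination δ * (f (i, j + 1) - f (i, j)) ^ 2 * p2
    have e3 : (f (i, j + 1) - f (i + 1, j)) ^ 2 * PP a b L (i, j + 1) * (ρ * i * ((j : ℝ) + 1))
        = (ρ * L) * (PP a b L (i, j) * (i * up2 a b (i, j) *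
          (f (i + 1, j) - f (i, j + 1)) ^ 2)) := by
      linear_combination ρ * i * (f (i + 1, j) - f (i, j + 1)) ^ 2 * p2
    have e4 : (f (i + 1, j) - f (i, j + 1)) ^ 2 * PP a b L (i + 1, j) * (ρ * ((i : ℝ) + 1) * j)
        = (ρ * L) * (PP a b L (i, j) * (j * up1 a b (i, j) *
          (f (i + 1, j) - f (i, j + 1)) ^ 2)) := by
      linear_combination ρ * j * (f (i + 1, j) - f (i, j + 1)) ^ 2 * p1
    rw [e1, e2, e3, e4]
    simp only [lX, lE]
    have hδ' := hδ.ne'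
    have hρ' := hρ.ne'
    have hL' := hL.ne'
    field_simp
    ring
  refine (ENNReal.tsum_le_tsum key).trans ?_
  rw [ENNReal.tsum_add, ENNReal.tsum_mul_left, ENNReal.tsum_mul_left, ENNReal.tsum_add,
    ENNReal.tsum_add]
  calc _ ≤ ENNReal.ofReal (d / (δ * L)) * (∑' p, T p + ∑' p, T p)
        + ENNReal.ofReal (c / (ρ * L)) * (∑' p, T p + ∑' p, T p) := by gcongr
    _ = _ := by
      rw [ENNReal.ofReal_mul (by norm_num), ENNReal.ofReal_add (by positivity) (by positivity)]
      simp only [ENNReal.ofReal_ofNat]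
      ring

theorem poincare (a b L : ℝ) (ha : 0 < a) (hb : 0 < b) (hL : 0 < L) (f : ℕ × ℕ → ℝ)
    (h0 : f (0, 0) = 0) :
    ∑' x, ENNReal.ofReal (PP a b L x * f x ^ 2)
      ≤ ∑' z, ENNReal.ofReal (PP a b L z * (L * (1 + a + b) / (a + b) * lX a b f z
        + (2 * L + L * Real.exp L) * lE a b f z)) := by
  rw [tsum_antidiag, tsum_antidiag]
  have hH : ∀ z, 0 ≤ L * (1 + a + b) / (a + b) * lX a b f z
        + (2 * L + L * Real.exp L) * lE a b f z := by
    intro z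
    have := lX_nonneg a b ha hb f z
    have := lE_nonneg a b ha hb f z
    positivity
  have conv : ∀ (F : ℕ × ℕ → ℝ), (∀ z, 0 ≤ F z) → ∀ n,
      ∑ x ∈ Finset.HasAntidiagonal.antidiagonal n, ENNReal.ofReal (PP a b L x * F x)
        = ENNReal.ofReal (pw L n * lS a b n F) := by
    intro F hF n
    rw [← ENNReal.ofReal_sum_of_nonneg fun x _ => mul_nonneg (PP_nonneg a b L ha hb hL x) (hF x),
      PP_level]
  have nn : ∀ (F : ℕ × ℕ → ℝ), (∀ z, 0 ≤ F z) → ∀ n, 0 ≤ pw L n * lS a b n F :=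
    fun F hF n => mul_nonneg (pw_nonneg L hL n)
      (Finset.sum_nonneg fun x _ => mul_nonneg (bw_nonneg a b ha hb x) (hF x))
  simp only [conv _ hH, conv (fun x => f x ^ 2) (fun z => sq_nonneg _)]
  refine ENNReal.tsum_le_of_sum_range_le fun N => ?_
  refine le_trans ?_ (ENNReal.sum_le_tsum (Finset.range N))
  refine (Finset.sum_le_sum_of_subset (Finset.range_mono (Nat.le_succ N))).trans ?_
  rw [← ENNReal.ofReal_sum_of_nonneg fun n _ => nn (fun x => f x ^ 2) (fun z => sq_nonneg _) n,
    ← ENNReal.ofReal_sum_of_nonneg fun n _ => nn _ hH n]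
  exact ENNReal.ofReal_le_ofReal (trunc a b L ha hb hL f h0 N)

/-- Example 3.3, positive spectral gap for the autocatalytic network. -/
theorem example_3_3_gap (κ1 κ2 δ ρ : ℝ)
    (h1 : 0 < κ1) (h2 : 0 < κ2) (hδ : 0 < δ) (hρ : 0 < ρ) :
    ∃ C > 0, ∀ f : ℕ × ℕ → ℝ, (∃ Kb, ∀ x, |f x| ≤ Kb) →
      ENNReal.ofReal (C * varPi (piAuto κ1 κ2 δ ρ) f)
        ≤ Estar (piAuto κ1 κ2 δ ρ) (qAuto κ1 κ2 δ ρ) f := by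
  have hs : 0 < κ1 + κ2 := add_pos h1 h2
  rw [piAuto_eq]
  have ha : 0 < δ * κ1 / (ρ * (κ1 + κ2)) := by positivity
  have hb : 0 < δ * κ2 / (ρ * (κ1 + κ2)) := by positivity
  have hL : 0 < (κ1 + κ2) / δ := by positivity
  generalize δ * κ1 / (ρ * (κ1 + κ2)) = a at *
  generalize δ * κ2 / (ρ * (κ1 + κ2)) = b at *
  generalize (κ1 + κ2) / δ = L at *
  have hc : 0 < L * (1 + a + b) / (a + b) := by positivity
  have hd : 0 < 2 * L + L * Real.exp L := by positivity
  set c := L * (1 + a + b) / (a + b) with hcdef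
  set d := 2 * L + L * Real.exp L with hddef
  have hK : 0 < 2 * (c / (ρ * L) + d / (δ * L)) := by positivity
  set K := 2 * (c / (ρ * L) + d / (δ * L)) with hKdef
  refine ⟨1 / (2 * K), by positivity, ?_⟩
  rintro f ⟨Kb, hKb⟩
  have hP := PP_tsum a b L ha hb hL
  have hP0 := PP_nonneg a b L ha hb hL
  obtain ⟨hsum, hvar⟩ := var_le (PP a b L) f hP hP0 Kb (f (0, 0)) hKb
  have hpo := poincare a b L ha hb hL (fun x => f x - f (0, 0)) (by simp)
  have hen := energy κ1 κ2 δ ρ a b L ha hb hL hδ hρ (fun x => f x - f (0, 0)) c d hc.le hd.le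
  have hv : ENNReal.ofReal (varPi (PP a b L) f) ≤
      ENNReal.ofReal K * ∑' p : (ℕ × ℕ) × (ℕ × ℕ), ENNReal.ofReal ((f p.1 - f p.2) ^ 2 *
        PP a b L p.1 * qAuto κ1 κ2 δ ρ p.1 p.2) := by
    refine (ENNReal.ofReal_le_ofReal hvar).trans ?_
    rw [ENNReal.ofReal_tsum_of_nonneg (fun x => mul_nonneg (hP0 x) (sq_nonneg _)) hsum]
    refine (hpo.trans hen).trans (le_of_eq ?_)
    simp only [sub_sub_sub_cancel_right]
    rfl
  rw [ENNReal.ofReal_mul (by positivity), Estar]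
  refine (mul_le_mul_right hv _).trans (le_of_eq ?_)
  rw [← mul_assoc, ← ENNReal.ofReal_mul (by positivity)]
  have : 1 / (2 * K) * K = 2⁻¹ := by field_simp
  rw [this, ENNReal.ofReal_inv_of_pos (by norm_num), ENNReal.ofReal_ofNat, mul_comm,
    ENNReal.div_eq_inv_mul, mul_comm]
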